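/- Let k be an infinite field of characteristic p ≠ 2 and let m ≥ 2 be an integer; set b_m = ⌊m/2⌋ + 1. For any positive integers t, n, r_1, …, r_n with t ≤ n and, if p > 2, p not dividing r_t, the intersection of the k-linear span of M'_{t,n}(r_1,…,r_n) with CP(G(m)) is contained in the T-space of k⟨X⟩ generated by x_{2b_m−1} · h_{b_m−1}, and this T-space is contained in CP(G(m)). -/

import Mathlib

noncomputable section

/-- The `i`-th variable `x_i` of the free unital associative algebra `k⟨X⟩`. -/
def xx (k : Type*) [Field k] (i : ℕ) : FreeAlgebra k ℕ := FreeAlgebra.ι k i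

/-- Commutator `[a,b] = ab - ba`. -/
def brk {A : Type*} [Ring A] (a b : A) : A := a * b - b * a

/-- `h_j = ∏_{r=1}^{j} [x_{2r-1}, x_{2r}]`. -/
def hh (k : Type*) [Field k] (j : ℕ) : FreeAlgebra k ℕ :=
  ((List.range j).map (fun r => brk (xx k (2 * r + 1)) (xx k (2 * r + 2)))).prod

/-- The elements of `M'_{t,n}(r_1,…,r_n)` (elements of Siderov's set `SS` whose
beginning is nonempty and contains `x_t`, whose variables lie in `{x_1,…,x_n}` and
whose degree in `x_i` is `r i`), restricted by a predicate `P` on the end length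
`lend(u) = s`. -/
def MSet (k : Type*) [Field k] (t n : ℕ) (r : ℕ → ℕ) (P : ℕ → Prop) :
    Set (FreeAlgebra k ℕ) :=
  {u | ∃ (tb s : ℕ) (i : Fin tb → ℕ) (α : Fin tb → ℕ)
        (j : Fin (2 * s) → ℕ) (β : Fin (2 * s) → ℕ),
    1 ≤ tb ∧ StrictMono i ∧ StrictMono j ∧
    (∀ a, 1 ≤ i a ∧ i a ≤ n) ∧ (∀ b, 1 ≤ j b ∧ j b ≤ n) ∧
    (∀ a b, i a ≠ j b) ∧
    (∀ a, 1 ≤ α a) ∧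
    (∃ a, i a = t) ∧
    (∀ a, α a = r (i a)) ∧ (∀ b, β b + 1 = r (j b)) ∧
    (∀ v, 1 ≤ v → v ≤ n → (∃ a, i a = v) ∨ (∃ b, j b = v)) ∧
    P s ∧
    u = (List.ofFn fun a => (xx k (i a)) ^ (α a)).prod *
        (List.ofFn fun rr : Fin s =>
          brk (xx k (j ⟨2 * rr.1, by omega⟩)) (xx k (j ⟨2 * rr.1 + 1, by omega⟩)) *
            (xx k (j ⟨2 * rr.1, by omega⟩)) ^ (β ⟨2 * rr.1, by omega⟩) *
            (xx k (j ⟨2 * rr.1 + 1, by omega⟩)) ^ (β ⟨2 * rr.1 + 1, by omega⟩)).prod}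

section commutators

variable {k A : Type*} [Field k] [Ring A] [Algebra k A]

/-- The linear span of all commutators. -/
def commSpan (k A : Type*) [Field k] [Ring A] [Algebra k A] : Submodule k A :=
  Submodule.span k {y | ∃ a b : A, y = brk a b}

lemma brk_mem_commSpan (a b : A) : brk a b ∈ commSpan k A :=
  Submodule.subset_span ⟨a, b, rfl⟩

lemma commSpan_mul_top_le : commSpan k A * ⊤ ≤ ⊤ * commSpan k A := by
  refine Submodule.mul_le.2 fun c hc d _ => ?_
  have : c * d = d * c + 1 * brk c d := by simp [brk]
  rw [this]
  exact add_mem (Submodule.mul_mem_mul trivial hc)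
    (Submodule.mul_mem_mul trivial (brk_mem_commSpan c d))

lemma top_mul_top_eq : (⊤ : Submodule k A) * ⊤ = ⊤ :=
  top_le_iff.1 fun a _ => mul_one a ▸ Submodule.mul_mem_mul trivial trivial

lemma commSpan_pow_mul_top_le (l : ℕ) : commSpan k A ^ l * ⊤ ≤ ⊤ * commSpan k A ^ l := by
  induction l with
  | zero => simp
  | succ l ih =>
    calc commSpan k A ^ (l + 1) * ⊤ = commSpan k A ^ l * (commSpan k A * ⊤) := by
          rw [pow_succ, mul_assoc]
      _ ≤ commSpan k A ^ l * (⊤ * commSpan k A) := mul_le_mul_right commSpan_mul_top_le _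
      _ = commSpan k A ^ l * ⊤ * commSpan k A := (mul_assoc _ _ _).symm
      _ ≤ ⊤ * commSpan k A ^ l * commSpan k A := mul_le_mul_left ih _
      _ = ⊤ * commSpan k A ^ (l + 1) := by rw [pow_succ, mul_assoc]

lemma top_mul_commSpan_pow_mul_top_le (l : ℕ) :
    ⊤ * commSpan k A ^ l * ⊤ ≤ ⊤ * commSpan k A ^ l := by
  calc ⊤ * commSpan k A ^ l * ⊤ = ⊤ * (commSpan k A ^ l * ⊤) := mul_assoc _ _ _
    _ ≤ ⊤ * (⊤ * commSpan k A ^ l) := mul_le_mul_right (commSpan_pow_mul_top_le l) _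
    _ = ⊤ * commSpan k A ^ l := by rw [← mul_assoc, top_mul_top_eq]

lemma top_mul_commSpan_pow_anti {l l' : ℕ} (h : l ≤ l') :
    (⊤ : Submodule k A) * commSpan k A ^ l' ≤ ⊤ * commSpan k A ^ l := by
  obtain ⟨d, rfl⟩ := Nat.exists_eq_add_of_le' h
  rw [pow_add, ← mul_assoc]
  exact mul_le_mul_left le_top _

lemma prod_mem_top_mul_commSpan_pow (L : List A)
    (hL : ∀ y ∈ L, y ∈ (⊤ : Submodule k A) * commSpan k A) :
    L.prod ∈ (⊤ : Submodule k A) * commSpan k A ^ L.length := by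
  induction L with
  | nil => simp
  | cons y L ih =>
    rw [List.prod_cons, List.length_cons]
    have hmem := Submodule.mul_mem_mul (hL y (by simp)) (ih fun z hz => hL z (by simp [hz]))
    have hle : (⊤ : Submodule k A) * commSpan k A * (⊤ * commSpan k A ^ L.length) ≤
        ⊤ * commSpan k A ^ (L.length + 1) := by
      have := top_mul_commSpan_pow_mul_top_le (k := k) (A := A) 1
      rw [pow_one] at this
      calc _ = ⊤ * commSpan k A * ⊤ * commSpan k A ^ L.length := (mul_assoc _ _ _).symm
        _ ≤ ⊤ * commSpan k A * commSpan k A ^ L.length := mul_le_mul_left this _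
        _ = _ := by rw [pow_succ', mul_assoc]
    exact hle hmem

/-- `Cˡ` is spanned by the products `[b₁, c₁] ⋯ [b_l, c_l]`. -/
lemma commSpan_pow_eq_span (l : ℕ) :
    commSpan k A ^ l = Submodule.span k
      {y | ∃ b c : ℕ → A, y = ((List.range l).map fun i => brk (b i) (c i)).prod} := by
  induction l with
  | zero => simp [Submodule.one_eq_span]
  | succ l ih =>
    rw [pow_succ, ih, commSpan, Submodule.span_mul_span]
    congr 1
    ext y
    simp only [Set.mem_mul, Set.mem_ofPred_eq]
    constructor
    · rintro ⟨_, ⟨b, c, rfl⟩, _, ⟨u, v, rfl⟩, rfl⟩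
      refine ⟨Function.update b l u, Function.update c l v, ?_⟩
      rw [List.range_succ, List.map_append, List.prod_append]
      simp only [List.map_cons, List.map_nil, List.prod_cons, List.prod_nil, mul_one,
        Function.update_self]
      congr 2
      refine List.map_congr_left fun i hi => ?_
      have : i ≠ l := (List.mem_range.1 hi).ne
      simp [this]
    · rintro ⟨b, c, rfl⟩
      exact ⟨_, ⟨b, c, rfl⟩, _, ⟨b l, c l, rfl⟩, by simp [List.range_succ]⟩

end commutators

lemma map_brk {k A B : Type*} [Field k] [Ring A] [Algebra k A] [Ring B] [Algebra k B]
    (φ : A →ₐ[k] B) (a b : A) : φ (brk a b) = brk (φ a) (φ b) := by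
  simp [brk]

lemma map_hh {k A : Type*} [Field k] [Ring A] [Algebra k A] (φ : FreeAlgebra k ℕ →ₐ[k] A)
    (l : ℕ) : φ (hh k l) = ((List.range l).map fun i =>
      brk (φ (xx k (2 * i + 1))) (φ (xx k (2 * i + 2)))).prod := by
  simp [hh, map_list_prod, List.map_map, Function.comp_def, map_brk]

/-- The T-space generated by `x_{2l+1} h_l` contains `A·Cˡ`. -/
lemma top_mul_commSpan_pow_le_tspace (k : Type*) [Field k] (l : ℕ) :
    (⊤ : Submodule k (FreeAlgebra k ℕ)) * commSpan k (FreeAlgebra k ℕ) ^ l ≤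
      Submodule.span k {y : FreeAlgebra k ℕ |
        ∃ ψ : FreeAlgebra k ℕ →ₐ[k] FreeAlgebra k ℕ, y = ψ (xx k (2 * l + 1) * hh k l)} := by
  rw [commSpan_pow_eq_span, ← Submodule.span_univ, Submodule.span_mul_span]
  refine Submodule.span_mono ?_
  rintro _ ⟨a, -, _, ⟨b, c, rfl⟩, rfl⟩
  refine ⟨FreeAlgebra.lift k fun v =>
    if v = 2 * l + 1 then a else if v % 2 = 1 then b (v / 2) else c (v / 2 - 1), ?_⟩
  rw [map_mul, map_hh]
  simp only [xx, FreeAlgebra.lift_ι_apply, if_true]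
  congr 2
  refine List.map_congr_left fun i hi => ?_
  have hi := List.mem_range.1 hi
  rw [if_neg (by omega), if_pos (by omega), if_neg (by omega), if_neg (by omega)]
  congr 2 <;> omega

section exterior

open ExteriorAlgebra

variable {k M : Type*} [Field k] [AddCommGroup M] [Module k M]

lemma ι_mul_ι_swap (x y : M) : ι k x * ι k y = -(ι k y * ι k x) := by
  rw [eq_neg_iff_add_eq_zero, ← ι_add_mul_swap x y]

lemma one_add_ι_pow (x : M) (d : ℕ) :
    (1 + ι k x) ^ d = 1 + (d : ExteriorAlgebra k M) * ι k x := by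
  induction d with
  | zero => simp
  | succ d ih =>
    have := ι_sq_zero (R := k) x
    rw [pow_succ, ih]
    simp only [mul_add, add_mul, one_mul, mul_one, mul_assoc, this, mul_zero, Nat.cast_succ]
    abel

lemma ι_mul_ι_mul_ι_left (x y : M) : ι k x * ι k y * ι k x = 0 := by
  rw [mul_assoc, ι_mul_ι_swap y x, mul_neg, ← mul_assoc, ι_sq_zero, zero_mul, neg_zero]

lemma ι_mul_ι_mul_ι_right (x y : M) : ι k x * ι k y * ι k y = 0 := by
  rw [mul_assoc, ι_sq_zero, mul_zero]

lemma commute_ι_ι_mul_ι (x y z : M) : Commute (ι k z) (ι k x * ι k y) := by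
  rw [Commute, SemiconjBy, ← mul_assoc, ι_mul_ι_swap z x, neg_mul, mul_assoc, ι_mul_ι_swap z y,
    mul_neg, neg_neg, mul_assoc]

lemma brk_one_add_ι (x y : M) :
    brk (1 + ι k x) (1 + ι k y) = (2 : k) • (ι k x * ι k y) := by
  have h := ι_mul_ι_swap (k := k) y x
  simp only [brk, mul_add, add_mul, one_mul, mul_one, h, two_smul]
  abel

lemma brk_one_add_ι_mul_pow (x y : M) (d d' : ℕ) :
    brk (1 + ι k x) (1 + ι k y) * (1 + ι k x) ^ d * (1 + ι k y) ^ d' =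
      (2 : k) • (ι k x * ι k y) := by
  rw [brk_one_add_ι, one_add_ι_pow, one_add_ι_pow]
  have h1 : ι k x * ι k y * (1 + (d : ExteriorAlgebra k M) * ι k x) = ι k x * ι k y := by
    rw [mul_add, mul_one, ← mul_assoc, ← Nat.cast_comm, mul_assoc, ι_mul_ι_mul_ι_left, mul_zero,
      add_zero]
  have h2 : ι k x * ι k y * (1 + (d' : ExteriorAlgebra k M) * ι k y) = ι k x * ι k y := by
    rw [mul_add, mul_one, ← mul_assoc, ← Nat.cast_comm, mul_assoc, ι_mul_ι_mul_ι_right, mul_zero,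
      add_zero]
  simp only [smul_mul_assoc, h1, h2]

/-- If `d ≠ 0` and `(1 + d x) P` commutes with `y`, where `P` is central, then `P x y = 0`. -/
lemma mul_ι_mul_ι_eq_zero {P : ExteriorAlgebra k M} (hP : ∀ z, Commute (ι k z) P) (h2 : (2 : k) ≠ 0)
    {d : ℕ} (hd : (d : k) ≠ 0) (x y : M)
    (h : (1 + (d : ExteriorAlgebra k M) * ι k x) * P * ι k y =
      ι k y * ((1 + (d : ExteriorAlgebra k M) * ι k x) * P)) :
    P * (ι k x * ι k y) = 0 := by
  have hd' : (d : ExteriorAlgebra k M) = algebraMap k _ (d : k) := by simp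
  have hx := (hP x).eq
  have hy := (hP y).eq
  rw [hd'] at h
  simp only [← Algebra.smul_def, add_mul, mul_add, one_mul, smul_mul_assoc, mul_smul_comm,
    hy, add_right_inj] at h
  have e1 : ι k x * P * ι k y = P * (ι k x * ι k y) := by rw [hx, mul_assoc]
  have e2 : ι k y * (ι k x * P) = -(P * (ι k x * ι k y)) := by
    rw [hx, ← mul_assoc, hy, mul_assoc, ι_mul_ι_swap, mul_neg]
  rw [e1, e2, smul_right_inj hd, eq_neg_iff_add_eq_zero, ← two_smul k] at h
  exact (smul_eq_zero.1 h).resolve_left h2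

/-- The standard basis vector of `k^m` with (zero-based) index `b`, or `0` if `m ≤ b`. -/
def stdVec (k : Type*) [Field k] (m b : ℕ) : Fin m → k := fun i => if (i : ℕ) = b then 1 else 0

lemma ιMulti_stdVec_ne_zero {m d : ℕ} (hd : d ≤ m) :
    (List.ofFn fun b : Fin d => ι k (stdVec k m b)).prod ≠ 0 := by
  rw [← ιMulti_apply]
  intro h
  let D : (Fin m → k) [⋀^Fin d]→ₗ[k] k :=
    Matrix.detRowAlternating.compLinearMap (LinearMap.funLeft k k (Fin.castLE hd))
  have h1 := liftAlternating_apply_ιMulti (R := k)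
    (Pi.single (M := fun i => (Fin m → k) [⋀^Fin i]→ₗ[k] k) d D)
    (fun b : Fin d => stdVec k m b)
  rw [h, map_zero, Pi.single_eq_same] at h1
  have h2 : (fun b : Fin d => LinearMap.funLeft k k (Fin.castLE hd) (stdVec k m b)) =
      (1 : Matrix (Fin d) (Fin d) k) := by
    ext a b
    simp [stdVec, Matrix.one_apply, LinearMap.funLeft_apply, Fin.ext_iff, eq_comm]
  have h3 : D (fun b : Fin d => stdVec k m b) = 1 := by
    change Matrix.det (fun b : Fin d => LinearMap.funLeft k k (Fin.castLE hd) (stdVec k m b)) = 1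
    rw [h2, Matrix.det_one]
  exact one_ne_zero (h3.symm.trans h1.symm)

end exterior

lemma prod_ofFn_pairs {A : Type*} [Monoid A] (g : ℕ → A) (s : ℕ) :
    (List.ofFn fun c : Fin s => g (2 * c) * g (2 * c + 1)).prod =
      (List.ofFn fun b : Fin (2 * s) => g b).prod := by
  induction s with
  | zero => simp
  | succ s ih =>
    rw [List.ofFn_succ', List.concat_eq_append, List.prod_append]
    have : 2 * (s + 1) = 2 * s + 1 + 1 := by ring
    rw [List.ofFn_congr this, List.ofFn_succ', List.concat_eq_append, List.prod_append,
      List.ofFn_succ', List.concat_eq_append, List.prod_append]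
    simp [ih, mul_assoc]

lemma prod_ofFn_smul {k A : Type*} [Field k] [Ring A] [Algebra k A] {s : ℕ} (c : k)
    (g : Fin s → A) : (List.ofFn fun a => c • g a).prod = c ^ s • (List.ofFn g).prod := by
  induction s with
  | zero => simp
  | succ s ih => simp [List.ofFn_succ, ih, smul_smul, pow_succ]

/-- The element of `SS` with beginning variables `i`, end variables `j`, and degrees `r`. -/
def siderovMon (k : Type*) [Field k] (r : ℕ → ℕ) {q s : ℕ} (i : Fin q → ℕ)
    (j : Fin (2 * s) → ℕ) : FreeAlgebra k ℕ :=
  (List.ofFn fun a => xx k (i a) ^ r (i a)).prod *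
    (List.ofFn fun c : Fin s =>
      brk (xx k (j ⟨2 * c.1, by omega⟩)) (xx k (j ⟨2 * c.1 + 1, by omega⟩)) *
        xx k (j ⟨2 * c.1, by omega⟩) ^ (r (j ⟨2 * c.1, by omega⟩) - 1) *
        xx k (j ⟨2 * c.1 + 1, by omega⟩) ^ (r (j ⟨2 * c.1 + 1, by omega⟩) - 1)).prod

/-- `u` is the element of `M'_{t,n}(r)` whose end has the set of variables `J`. -/
def IsSiderovMon (k : Type*) [Field k] (t n : ℕ) (r : ℕ → ℕ) (J : Finset ℕ)
    (u : FreeAlgebra k ℕ) : Prop :=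
  ∃ (q s : ℕ) (i : Fin q → ℕ) (j : Fin (2 * s) → ℕ), StrictMono i ∧ StrictMono j ∧
    Set.range i = Set.Icc 1 n \ J ∧ Set.range j = J ∧ t ∉ J ∧ u = siderovMon k r i j

lemma exists_isSiderovMon {k : Type*} [Field k] {t n : ℕ} {r : ℕ → ℕ} {P : ℕ → Prop}
    {u : FreeAlgebra k ℕ} (hu : u ∈ MSet k t n r P) : ∃ J, IsSiderovMon k t n r J u := by
  obtain ⟨q, s, i, α, j, β, -, hi, hj, hin, hjn, hij, -, ⟨a, ha⟩, hα, hβ, hcov, -, rfl⟩ := hu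
  refine ⟨Finset.univ.image j, q, s, i, j, hi, hj, ?_, by simp, ?_, ?_⟩
  · ext v
    simp only [Set.mem_range, Finset.coe_image, Finset.coe_univ, Set.image_univ, Set.mem_sdiff,
      Set.mem_Icc]
    constructor
    · rintro ⟨a, rfl⟩
      exact ⟨hin a, fun ⟨b, hb⟩ => hij a b hb.symm⟩
    · rintro ⟨⟨h1, h2⟩, h3⟩
      exact (hcov v h1 h2).resolve_right h3
  · rw [← ha]
    simpa using fun b hb => hij a b hb.symm
  · have hβ' : ∀ b, β b = r (j b) - 1 := fun b => by rw [← hβ b, Nat.add_sub_cancel]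
    simp only [siderovMon, hα, hβ']

namespace IsSiderovMon

variable {k : Type*} [Field k] {t n : ℕ} {r : ℕ → ℕ} {J : Finset ℕ} {u u' : FreeAlgebra k ℕ}

lemma card_eq_of_range {q : ℕ} {J : Finset ℕ} {j : Fin q → ℕ} (hj : StrictMono j)
    (h : Set.range j = J) : J.card = q := by
  rw [← Set.ncard_coe_finset, ← h, ← Set.image_univ, Set.ncard_image_of_injective _ hj.injective]
  simp

lemma unique (hu : IsSiderovMon k t n r J u) (hu' : IsSiderovMon k t n r J u') : u = u' := by
  obtain ⟨q, s, i, j, hi, hj, hiJ, hjJ, -, rfl⟩ := hu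
  obtain ⟨q', s', i', j', hi', hj', hiJ', hjJ', -, rfl⟩ := hu'
  have hs : s = s' := by
    have := card_eq_of_range hj hjJ
    have := card_eq_of_range hj' hjJ'
    omega
  have hcoe : ((Finset.Icc 1 n \ J : Finset ℕ) : Set ℕ) = Set.Icc 1 n \ J := by simp
  have hq : q = q' := (card_eq_of_range hi (hiJ.trans hcoe.symm)).symm.trans
    (card_eq_of_range hi' (hiJ'.trans hcoe.symm))
  subst hs hq
  rw [(StrictMono.range_inj hi hi').1 (hiJ.trans hiJ'.symm),
    (StrictMono.range_inj hj hj').1 (hjJ.trans hjJ'.symm)]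

lemma mem_top_mul_commSpan_pow (hu : IsSiderovMon k t n r J u) {l : ℕ} (hl : 2 * l ≤ J.card) :
    u ∈ (⊤ : Submodule k (FreeAlgebra k ℕ)) * commSpan k (FreeAlgebra k ℕ) ^ l := by
  obtain ⟨q, s, i, j, -, hj, -, hjJ, -, rfl⟩ := hu
  have hls : l ≤ s := by
    have := card_eq_of_range hj hjJ
    omega
  refine top_mul_commSpan_pow_anti hls ?_
  rw [← top_mul_top_eq, mul_assoc]
  refine Submodule.mul_mem_mul trivial ?_
  convert prod_mem_top_mul_commSpan_pow (k := k) _ ?_ using 2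
  · rw [List.length_ofFn]
  · simp only [List.mem_ofFn, forall_exists_index]
    rintro _ c rfl
    rw [mul_assoc]
    have h := top_mul_commSpan_pow_mul_top_le (k := k) (A := FreeAlgebra k ℕ) 1
    rw [pow_one] at h
    refine h (Submodule.mul_mem_mul ?_ trivial)
    simpa using Submodule.mul_mem_mul (M := (⊤ : Submodule k (FreeAlgebra k ℕ))) (m := 1)
      trivial (brk_mem_commSpan (k := k) _ _)

lemma map_eq_zero {A : Type*} [Ring A] [Algebra k A] (hu : IsSiderovMon k t n r J u)
    (φ : FreeAlgebra k ℕ →ₐ[k] A) {v : ℕ} (hv : v ∈ J) (hφ : φ (xx k v) = 1) : φ u = 0 := by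
  obtain ⟨q, s, i, j, -, -, -, hjJ, -, rfl⟩ := hu
  obtain ⟨b, rfl⟩ : v ∈ Set.range j := hjJ ▸ hv
  have hb : b.1 / 2 < s := by omega
  rw [siderovMon, map_mul]
  convert mul_zero _
  rw [map_list_prod]
  refine List.prod_eq_zero ?_
  rw [List.mem_map]
  refine ⟨_, List.mem_ofFn.2 ⟨⟨b.1 / 2, hb⟩, rfl⟩, ?_⟩
  rw [map_mul, map_mul, map_brk]
  rcases Nat.mod_two_eq_zero_or_one b.1 with h | h
  · have : (⟨2 * (b.1 / 2), by omega⟩ : Fin (2 * s)) = b := Fin.ext (by simp; omega)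
    simp only [this, hφ]
    simp [brk]
  · have : (⟨2 * (b.1 / 2) + 1, by omega⟩ : Fin (2 * s)) = b := Fin.ext (by simp; omega)
    simp only [this, hφ]
    simp [brk]

open ExteriorAlgebra in
/-- A separating substitution: it kills every element of `M'_{t,n}(r)` whose end involves a variable
outside `J`, and sends `u` to a noncentral element. -/
lemma exists_algHom (hu : IsSiderovMon k t n r J u) {m : ℕ} (hm : J.card + 2 ≤ m)
    (ht : t ∈ Set.Icc 1 n) (h2 : (2 : k) ≠ 0) (hrt : (r t : k) ≠ 0) :
    ∃ φ : FreeAlgebra k ℕ →ₐ[k] ExteriorAlgebra k (Fin m → k),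
      (∀ v, v ∉ J → v ≠ t → φ (xx k v) = 1) ∧ ∃ a, φ u * a ≠ a * φ u := by
  obtain ⟨q, s, i, j, hi, hj, hiJ, hjJ, htJ, rfl⟩ := hu
  have hs := card_eq_of_range hj hjJ
  let w : ℕ → Fin m → k := Function.extend j (fun b => stdVec k m b)
    fun v => if v = t then stdVec k m (2 * s) else 0
  have hwj (b) : w (j b) = stdVec k m b := hj.injective.extend_apply _ _ _
  have hwJ {v} (hv : v ∉ J) : w v = if v = t then stdVec k m (2 * s) else 0 :=
    Function.extend_apply' _ _ _ fun ⟨b, hb⟩ => hv (by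
      have : v ∈ Set.range j := ⟨b, hb⟩
      rwa [hjJ] at this)
  let φ : FreeAlgebra k ℕ →ₐ[k] ExteriorAlgebra k (Fin m → k) :=
    FreeAlgebra.lift k fun v => 1 + ι k (w v)
  have hφ (v) : φ (xx k v) = 1 + ι k (w v) := by simp [φ, xx]
  have hφ1 {v} (hv : v ∉ J) (hvt : v ≠ t) : φ (xx k v) = 1 := by
    simp [hφ, hwJ hv, hvt]
  let g : ℕ → ExteriorAlgebra k (Fin m → k) := fun b => ι k (stdVec k m b)
  let P := (List.ofFn fun c : Fin s => (2 : k) • (g (2 * c) * g (2 * c + 1))).prod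
  have hbeg : φ (List.ofFn fun a => xx k (i a) ^ r (i a)).prod = 1 + (r t : _) * g (2 * s) := by
    obtain ⟨a, rfl⟩ : t ∈ Set.range i := hiJ ▸ ⟨ht, htJ⟩
    rw [map_list_prod, List.map_ofFn, List.ofFn_eq_map,
      List.prod_map_eq_pow_single a, List.count_eq_one_of_mem (List.nodup_finRange q)
        (List.mem_finRange a), pow_one]
    · simp only [Function.comp, map_pow, hφ, hwJ htJ, if_true, one_add_ι_pow, g]
    · intro b hb _
      have : i b ∉ J := fun h => by
        have hmem : i b ∈ Set.Icc 1 n \ (J : Set ℕ) := hiJ ▸ ⟨b, rfl⟩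
        exact hmem.2 h
      simp [hφ1 this (hi.injective.ne hb)]
  have hu : φ (siderovMon k r i j) = (1 + (r t : _) * g (2 * s)) * P := by
    rw [siderovMon, map_mul, hbeg, map_list_prod, List.map_ofFn]
    congr 3
    funext c
    simp only [Function.comp, map_mul, map_brk, map_pow, hφ, hwj, brk_one_add_ι_mul_pow, g]
  refine ⟨φ, fun v => hφ1, g (2 * s + 1), fun h => ?_⟩
  rw [hu] at h
  have hP : ∀ z, Commute (ι k z) P := fun z => Commute.list_prod_right _ _ fun y hy => by
    obtain ⟨c, rfl⟩ := List.mem_ofFn.1 hy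
    exact (commute_ι_ι_mul_ι _ _ z).smul_right 2
  have h0 : P * (g (2 * s) * g (2 * s + 1)) = 0 := mul_ι_mul_ι_eq_zero hP h2 hrt _ _ h
  have hP' : P = (2 : k) ^ s • (List.ofFn fun b : Fin (2 * s) => g b).prod := by
    rw [← prod_ofFn_pairs, ← prod_ofFn_smul]
  have hne := ιMulti_stdVec_ne_zero (k := k) (m := m) (d := 2 * s + 1 + 1) (by omega)
  rw [List.ofFn_succ', List.concat_eq_append, List.prod_append,
      List.ofFn_succ', List.concat_eq_append, List.prod_append] at hne
  rw [hP', smul_mul_assoc, smul_eq_zero_iff_right (pow_ne_zero _ h2)] at h0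
  exact hne (by simpa [g, mul_assoc] using h0)

end IsSiderovMon

/-- A central combination of elements of `M'_{t,n}(r)` only involves ends of length at least
`⌊m/2⌋`. -/
lemma mem_top_mul_commSpan_pow_of_central {k : Type*} [Field k] {m t n : ℕ} {r : ℕ → ℕ}
    (ht : t ∈ Set.Icc 1 n) (h2 : (2 : k) ≠ 0) (hrt : (r t : k) ≠ 0) {P : ℕ → Prop}
    {f : FreeAlgebra k ℕ} (hf : f ∈ Submodule.span k (MSet k t n r P))
    (hc : ∀ φ : FreeAlgebra k ℕ →ₐ[k] ExteriorAlgebra k (Fin m → k), ∀ a, φ f * a = a * φ f) :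
    f ∈ (⊤ : Submodule k (FreeAlgebra k ℕ)) * commSpan k (FreeAlgebra k ℕ) ^ (m / 2) := by
  obtain ⟨c, hcs, rfl⟩ := Submodule.mem_span_set.1 hf
  choose! J hJ using fun u (hu : u ∈ MSet k t n r P) => exists_isSiderovMon hu
  have hJ' {u} (hu : u ∈ c.support) : IsSiderovMon k t n r (J u) u := hJ u (hcs hu)
  refine Submodule.sum_mem _ fun u hu => Submodule.smul_mem _ _ ?_
  refine (hJ' hu).mem_top_mul_commSpan_pow ?_
  obtain ⟨u₀, hu₀, hmin⟩ := c.support.exists_min_image (fun u => (J u).card) ⟨u, hu⟩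
  refine le_trans ?_ (hmin u hu)
  by_contra! hlt
  have hcard : (J u₀).card + 2 ≤ m := by
    obtain ⟨q, s, i, j, -, hj, -, hjJ, -⟩ := hJ' hu₀
    have := IsSiderovMon.card_eq_of_range hj hjJ
    omega
  obtain ⟨φ, hφ, a, ha⟩ := (hJ' hu₀).exists_algHom hcard ht h2 hrt
  have hsum : φ (c.sum fun u x => x • u) = c u₀ • φ u₀ := by
    rw [Finsupp.sum, map_sum, Finset.sum_eq_single_of_mem u₀ hu₀, map_smul]
    intro v hv hvu
    obtain ⟨x, hx, hx₀⟩ : ∃ x ∈ J v, x ∉ J u₀ := by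
      by_contra! hsub
      have := Finset.eq_of_subset_of_card_le hsub (hmin v hv)
      exact hvu ((hJ' hv).unique (this ▸ hJ' hu₀))
    have hxt : x ≠ t := by
      obtain ⟨q, s, i, j, -, -, -, -, htJ, -⟩ := hJ' hv
      rintro rfl
      exact htJ hx
    rw [map_smul, (hJ' hv).map_eq_zero φ hx (hφ x hx₀ hxt), smul_zero]
  have := hc φ a
  rw [hsum, smul_mul_assoc, mul_smul_comm] at this
  exact ha (smul_right_injective _ (Finsupp.mem_support_iff.1 hu₀) this)

section center

open ExteriorAlgebra

variable {k M : Type*} [Field k] [AddCommGroup M] [Module k M]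

/-- The center as a submodule. -/
abbrev centerSubmodule (k A : Type*) [Field k] [Ring A] [Algebra k A] : Submodule k A :=
  Subalgebra.toSubmodule (Subalgebra.center k A)

lemma mul_centerSubmodule_le {A : Type*} [Ring A] [Algebra k A] (N : Submodule k A) :
    N * centerSubmodule k A ≤ centerSubmodule k A * N :=
  Submodule.mul_le.2 fun a ha z hz => by
    rw [Subalgebra.mem_center_iff (R := k).1 hz a]
    exact Submodule.mul_mem_mul hz ha

lemma mul_centerSubmodule_pow_le {A : Type*} [Ring A] [Algebra k A] (N : Submodule k A) (l : ℕ) :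
    (centerSubmodule k A * N) ^ l ≤ centerSubmodule k A * N ^ l := by
  induction l with
  | zero => simp
  | succ l ih =>
    calc (centerSubmodule k A * N) ^ (l + 1)
        ≤ centerSubmodule k A * N ^ l * (centerSubmodule k A * N) := by
          rw [pow_succ]; exact mul_le_mul_left ih _
      _ = centerSubmodule k A * (N ^ l * centerSubmodule k A) * N := by simp only [mul_assoc]
      _ ≤ centerSubmodule k A * (centerSubmodule k A * N ^ l) * N :=
          mul_le_mul_left (mul_le_mul_right (mul_centerSubmodule_le _) _) _
      _ = centerSubmodule k A * N ^ (l + 1) := by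
          rw [← mul_assoc, Subalgebra.isIdempotentElem_toSubmodule, mul_assoc, pow_succ]

lemma mem_center_of_commute_ι {z : ExteriorAlgebra k M} (h : ∀ x, Commute (ι k x) z) :
    z ∈ Subalgebra.center k (ExteriorAlgebra k M) := by
  refine Subalgebra.mem_center_iff.2 fun b => ?_
  induction b using ExteriorAlgebra.induction with
  | algebraMap c => exact Algebra.commutes c z
  | ι x => exact h x
  | mul a b ha hb => exact (Commute.mul_left ha hb : Commute (a * b) z)
  | add a b ha hb => exact (Commute.add_left ha hb : Commute (a + b) z)

lemma ι_mul_ι_mem_center (x y : M) : ι k x * ι k y ∈ Subalgebra.center k (ExteriorAlgebra k M) :=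
  mem_center_of_commute_ι fun z => commute_ι_ι_mul_ι x y z

/-- The exterior algebra is generated, as a module over its center, by `1` and the vectors. -/
lemma mem_center_sup_center_mul_range_ι (a : ExteriorAlgebra k M) :
    a ∈ centerSubmodule k (ExteriorAlgebra k M) ⊔
      centerSubmodule k (ExteriorAlgebra k M) * LinearMap.range (ι k) := by
  set Z := centerSubmodule k (ExteriorAlgebra k M)
  set V := LinearMap.range (ι k (M := M))
  have hVV : V * V ≤ Z := Submodule.mul_le.2 <| by
    rintro _ ⟨x, rfl⟩ _ ⟨y, rfl⟩
    exact ι_mul_ι_mem_center x y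
  have hZZ : Z * Z = Z := Subalgebra.isIdempotentElem_toSubmodule _
  have hmul : (Z ⊔ Z * V) * (Z ⊔ Z * V) ≤ Z ⊔ Z * V := by
    have h1 : Z * V * Z ≤ Z * V := by
      rw [mul_assoc]
      refine (mul_le_mul_right (mul_centerSubmodule_le V) Z).trans ?_
      rw [← mul_assoc, hZZ]
    have h2 : Z * V * (Z * V) ≤ Z := by
      rw [← mul_assoc]
      refine (mul_le_mul_left h1 V).trans ?_
      rw [mul_assoc]
      exact (mul_le_mul_right hVV Z).trans hZZ.le
    rw [Submodule.sup_mul, Submodule.mul_sup, Submodule.mul_sup, hZZ, ← mul_assoc Z Z V, hZZ]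
    exact sup_le le_rfl (sup_le (h1.trans le_sup_right) (h2.trans le_sup_left))
  induction a using ExteriorAlgebra.induction with
  | algebraMap c => exact Submodule.mem_sup_left (Subalgebra.algebraMap_mem _ c)
  | ι x =>
    refine Submodule.mem_sup_right ?_
    rw [← one_mul (ι k x)]
    exact Submodule.mul_mem_mul (one_mem (Subalgebra.center k _)) ⟨x, rfl⟩
  | mul a b ha hb => exact hmul (Submodule.mul_mem_mul ha hb)
  | add a b ha hb => exact add_mem ha hb

lemma brk_add_left {A : Type*} [Ring A] (a b c : A) : brk (a + b) c = brk a c + brk b c := by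
  simp only [brk, add_mul, mul_add]; abel

lemma brk_swap {A : Type*} [Ring A] (a b : A) : brk a b = -brk b a := by
  simp [brk]

lemma brk_eq_zero_of_mem_center {A : Type*} [Ring A] [Algebra k A] {a : A}
    (ha : a ∈ Subalgebra.center k A) (b : A) : brk a b = 0 := by
  rw [brk, Subalgebra.mem_center_iff.1 ha b, sub_self]

lemma brk_mul_ι_mul_ι {z z' : ExteriorAlgebra k M} (hz : z ∈ Subalgebra.center k _)
    (hz' : z' ∈ Subalgebra.center k _) (x y : M) :
    brk (z * ι k x) (z' * ι k y) = (2 : k) • (z * z' * (ι k x * ι k y)) := by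
  have h1 : z * ι k x * (z' * ι k y) = z * z' * (ι k x * ι k y) := by
    rw [mul_assoc, ← mul_assoc (ι k x), Subalgebra.mem_center_iff.1 hz' (ι k x)]
    simp only [mul_assoc]
  have h2 : z' * ι k y * (z * ι k x) = -(z * z' * (ι k x * ι k y)) := by
    rw [mul_assoc, ← mul_assoc (ι k y), Subalgebra.mem_center_iff.1 hz (ι k y), mul_assoc,
      ι_mul_ι_swap y x, ← mul_assoc, Subalgebra.mem_center_iff.1 hz z', mul_neg]
  rw [brk, h1, h2, sub_neg_eq_add, two_smul]

lemma brk_mem_center_mul_range_ι_sq (a b : ExteriorAlgebra k M) :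
    brk a b ∈ centerSubmodule k (ExteriorAlgebra k M) * LinearMap.range (ι k) ^ 2 := by
  obtain ⟨a₀, ha₀, a₁, ha₁, rfl⟩ := Submodule.mem_sup.1 (mem_center_sup_center_mul_range_ι a)
  obtain ⟨b₀, hb₀, b₁, hb₁, rfl⟩ := Submodule.mem_sup.1 (mem_center_sup_center_mul_range_ι b)
  rw [brk_add_left, brk_eq_zero_of_mem_center (k := k) ha₀, zero_add, brk_swap, brk_add_left,
    brk_eq_zero_of_mem_center (k := k) hb₀, zero_add, ← brk_swap]
  induction ha₁ using Submodule.mul_induction_on' with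
  | mem_mul_mem z hz v hv =>
    obtain ⟨x, rfl⟩ := hv
    induction hb₁ using Submodule.mul_induction_on' with
    | mem_mul_mem z' hz' v hv =>
      obtain ⟨y, rfl⟩ := hv
      rw [brk_mul_ι_mul_ι hz hz', pow_two]
      exact Submodule.smul_mem _ _ (Submodule.mul_mem_mul
        ((Subalgebra.center k (ExteriorAlgebra k M)).mul_mem hz hz')
        (Submodule.mul_mem_mul ⟨x, rfl⟩ ⟨y, rfl⟩))
    | add c _ d _ hc hd =>
      rw [brk_swap, brk_add_left, neg_add, ← brk_swap, ← brk_swap]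
      exact add_mem hc hd
  | add c _ d _ hc hd =>
    rw [brk_add_left]
    exact add_mem hc hd

lemma brk_mem_center (a b : ExteriorAlgebra k M) :
    brk a b ∈ Subalgebra.center k (ExteriorAlgebra k M) := by
  have h : centerSubmodule k (ExteriorAlgebra k M) * LinearMap.range (ι k) ^ 2 ≤
      centerSubmodule k (ExteriorAlgebra k M) := by
    refine Submodule.mul_le.2 fun z hz v hv =>
      (Subalgebra.center k (ExteriorAlgebra k M)).mul_mem hz ?_
    rw [pow_two] at hv
    refine (Submodule.mul_le.2 ?_ : _ ≤ centerSubmodule k (ExteriorAlgebra k M)) hv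
    rintro _ ⟨x, rfl⟩ _ ⟨y, rfl⟩
    exact ι_mul_ι_mem_center x y
  exact h (brk_mem_center_mul_range_ι_sq a b)

lemma range_ι_pow_eq_bot [Module.Finite k M] {d : ℕ} (hd : Module.finrank k M < d) :
    LinearMap.range (ι k (M := M)) ^ d = ⊥ := by
  change ⋀[k]^d M = ⊥
  rw [← ιMulti_span_fixedDegree, Submodule.span_eq_bot]
  rintro _ ⟨v, rfl⟩
  refine AlternatingMap.map_linearDependent _ _ fun h => ?_
  have := h.fintype_card_le_finrank
  rw [Fintype.card_fin] at this
  omega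

lemma commSpan_pow_eq_bot [Module.Finite k M] {l : ℕ} (hl : Module.finrank k M < 2 * l) :
    commSpan k (ExteriorAlgebra k M) ^ l = ⊥ := by
  have h : commSpan k (ExteriorAlgebra k M) ≤
      centerSubmodule k (ExteriorAlgebra k M) * LinearMap.range (ι k) ^ 2 := by
    refine Submodule.span_le.2 ?_
    rintro _ ⟨a, b, rfl⟩
    exact brk_mem_center_mul_range_ι_sq a b
  refine le_bot_iff.1 ((pow_le_pow_left' h l).trans ((mul_centerSubmodule_pow_le _ l).trans ?_))
  rw [← pow_mul, range_ι_pow_eq_bot hl, Submodule.mul_bot]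

lemma mul_prod_brk_central [Module.Finite k M] {l : ℕ} (hl : Module.finrank k M < 2 * (l + 1))
    (a d : ExteriorAlgebra k M) (b c : ℕ → ExteriorAlgebra k M) :
    a * ((List.range l).map fun i => brk (b i) (c i)).prod * d =
      d * (a * ((List.range l).map fun i => brk (b i) (c i)).prod) := by
  set P := ((List.range l).map fun i => brk (b i) (c i)).prod
  have hPc : P ∈ Subalgebra.center k (ExteriorAlgebra k M) := list_prod_mem fun y hy => by
    obtain ⟨i, -, rfl⟩ := List.mem_map.1 hy
    exact brk_mem_center _ _
  have hPC : P ∈ commSpan k (ExteriorAlgebra k M) ^ l := by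
    rw [commSpan_pow_eq_span]
    exact Submodule.subset_span ⟨b, c, rfl⟩
  have h0 : brk a d * P = 0 := by
    have := Submodule.mul_mem_mul (brk_mem_commSpan (k := k) a d) hPC
    rwa [← pow_succ', commSpan_pow_eq_bot hl, Submodule.mem_bot] at this
  rw [mul_assoc, ← Subalgebra.mem_center_iff.1 hPc d, ← mul_assoc, ← mul_assoc, ← sub_eq_zero,
    ← sub_mul]
  exact h0

end center

/-- Let `k` be an infinite field of characteristic `p ≠ 2`, `m ≥ 2`,
`b_m = ⌊m/2⌋ + 1`, and `t ≤ n`, `r_1, …, r_n ≥ 1` with `p ∤ r_t` when `p > 2`.  Then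
`span(M'_{t,n}(r_1,…,r_n)) ∩ CP(G(m)) ⊆ {x_{2b_m-1} h_{b_m-1}}^S ⊆ CP(G(m))`. -/
theorem stmt19 (k : Type*) [Field k] [Infinite k] (p : ℕ) [CharP k p] (hp : p ≠ 2)
    (m : ℕ) (hm : 2 ≤ m) (t n : ℕ) (ht : 1 ≤ t) (htn : t ≤ n) (r : ℕ → ℕ)
    (hr : ∀ i, 1 ≤ i → i ≤ n → 1 ≤ r i) (hrt : 2 < p → ¬ p ∣ r t) :
    (↑(Submodule.span k (MSet k t n r (fun _ => True))) : Set (FreeAlgebra k ℕ)) ∩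
      {f : FreeAlgebra k ℕ |
        ∀ φ : FreeAlgebra k ℕ →ₐ[k] ExteriorAlgebra k (Fin m → k),
          ∀ a, φ f * a = a * φ f} ⊆
    ↑(Submodule.span k {y : FreeAlgebra k ℕ |
        ∃ ψ : FreeAlgebra k ℕ →ₐ[k] FreeAlgebra k ℕ,
          y = ψ (xx k (2 * (m / 2 + 1) - 1) * hh k (m / 2 + 1 - 1))}) ∧
    (↑(Submodule.span k {y : FreeAlgebra k ℕ |
        ∃ ψ : FreeAlgebra k ℕ →ₐ[k] FreeAlgebra k ℕ,
          y = ψ (xx k (2 * (m / 2 + 1) - 1) * hh k (m / 2 + 1 - 1))}) : Set (FreeAlgebra k ℕ)) ⊆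
      {f : FreeAlgebra k ℕ |
        ∀ φ : FreeAlgebra k ℕ →ₐ[k] ExteriorAlgebra k (Fin m → k),
          ∀ a, φ f * a = a * φ f} := by
  have hindex : 2 * (m / 2 + 1) - 1 = 2 * (m / 2) + 1 := by omega
  rw [hindex, Nat.add_sub_cancel]
  have h2 : (2 : k) ≠ 0 := Ring.two_ne_zero (ringChar.eq k p ▸ hp)
  have hrt0 : (r t : k) ≠ 0 := by
    rw [Ne, CharP.cast_eq_zero_iff k p]
    have hpos := hr t ht htn
    rcases CharP.char_is_prime_or_zero k p with hprime | rfl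
    · exact hrt (lt_of_le_of_ne hprime.two_le hp.symm)
    · rw [zero_dvd_iff]
      omega
  refine ⟨fun f hf => top_mul_commSpan_pow_le_tspace k _
    (mem_top_mul_commSpan_pow_of_central ⟨ht, htn⟩ h2 hrt0 hf.1 hf.2), fun f hf φ a => ?_⟩
  induction hf using Submodule.span_induction with
  | mem y hy =>
    obtain ⟨ψ, rfl⟩ := hy
    rw [← AlgHom.comp_apply, map_mul, map_hh]
    exact mul_prod_brk_central (by rw [Module.finrank_fin_fun]; omega) _ _ _ _
  | zero => simp
  | add y z _ _ hy hz => rw [map_add, add_mul, mul_add, hy, hz]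
  | smul c y _ hy => rw [map_smul, smul_mul_assoc, mul_smul_comm, hy]

end
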